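/- Suppose for each v in [v̲, v̄] (with v̲ < v̄), H_v is the CDF of an integrable probability distribution on ℝ with continuous strictly positive density h_v on (V̲, V̄), where −∞ ≤ V̲ < V̄ ≤ ∞; for each fixed V in (V̲, V̄), the map v ↦ H_v(V) is continuously differentiable with ∂H_v(V)/∂v < 0 for all v in [v̲, v̄]; there exists an integrable function b : (V̲, V̄) → ℝ≥0 with |∂H_v(V)/∂v| ≤ b(V) for all v and V; the normalization ∫ V h_v(V) dV = v holds for every v; and Assumptions A1 and A2 hold. Then −∂H_v(V)/∂v = h_v(V) for all v in (v̲, v̄) and all V in (V̲, V̄); equivalently, γ(v, V) := −(∂H_v(V)/∂v)/h_v(V) equals 1 everywhere on (v̲, v̄) × (V̲, V̄). -/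

import Mathlib

open MeasureTheory Set

/-- The open interval `(a, b)` of real numbers, where the endpoints `a, b` are extended
reals (so `a = ⊥` means unbounded below and `b = ⊤` means unbounded above). -/
def ERIoo (a b : EReal) : Set ℝ := {x : ℝ | a < (x : EReal) ∧ (x : EReal) < b}

theorem ERIoo.measurableSet (a b : EReal) : MeasurableSet (ERIoo a b) :=
  measurable_coe_real_ereal measurableSet_Ioo

theorem ERIoo.ordConnected (a b : EReal) : (ERIoo a b).OrdConnected :=
  ⟨fun _ hx _ hy _ hz => ⟨hx.1.trans_le (EReal.coe_le_coe_iff.2 hz.1),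
    (EReal.coe_le_coe_iff.2 hz.2).trans_lt hy.2⟩⟩

theorem ERIoo.nonempty {a b : EReal} (hab : a < b) : (ERIoo a b).Nonempty :=
  EReal.lt_iff_exists_real_btwn.1 hab

/-- A relatively lower, proper, nonempty part of an interval is a.e. a half-line with endpoint in
the interval, simultaneously for all atomless measures carried by the interval. -/
theorem exists_ae_eq_Iic_of_lower {I S : Set ℝ} (hI : I.OrdConnected) (hSI : S ⊆ I)
    (hS : ∀ x ∈ S, ∀ z ∈ I, z ≤ x → z ∈ S) (hne : S.Nonempty) {y : ℝ} (hyI : y ∈ I) (hyS : y ∉ S) :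
    ∃ s ∈ I, ∀ ν : Measure ℝ, NullSingletonClass ν → (∀ᵐ x ∂ν, x ∈ I) → ν S = ν (Iic s) := by
  obtain ⟨x, hx⟩ := hne
  have hub : ∀ z ∈ S, z ≤ y := fun z hz => by
    by_contra! h
    exact hyS (hS z hz y hyI h.le)
  have hbdd : BddAbove S := ⟨y, hub⟩
  refine ⟨sSup S, hI.out (hSI hx) hyI ⟨le_csSup hbdd hx, csSup_le ⟨x, hx⟩ hub⟩, ?_⟩
  intro ν _ hν
  refine measure_congr ?_
  filter_upwards [hν, Measure.ae_ne ν (sSup S)] with z hzI hz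
  refine propext ⟨fun h => le_csSup hbdd h, fun h => ?_⟩
  obtain ⟨w, hwS, hw⟩ := exists_lt_of_lt_csSup ⟨x, hx⟩ (lt_of_le_of_ne h hz)
  exact hS w hwS z hzI hw.le

/-- If `ν'` strictly first-order stochastically dominates `ν` and the expectation of a nonnegative
antitone function is not smaller under `ν'`, then that function is constant. -/
theorem AntitoneOn.eq_of_strict_stochastic_dominance {I : Set ℝ} (hI : I.OrdConnected)
    (hIm : MeasurableSet I) {ν ν' : Measure ℝ} [NullSingletonClass ν] [NullSingletonClass ν']
    (hν : ∀ᵐ x ∂ν, x ∈ I) (hν' : ∀ᵐ x ∂ν', x ∈ I) (hmass : ν I = ν' I)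
    (hlt : ∀ s ∈ I, ν' (Iic s) < ν (Iic s)) {f : ℝ → ℝ} (hf : AntitoneOn f I)
    (hf0 : ∀ x ∈ I, 0 ≤ f x) (hfin : ∫⁻ x, ENNReal.ofReal (f x) ∂ν' ≠ ⊤)
    (hle : ∫⁻ x, ENNReal.ofReal (f x) ∂ν ≤ ∫⁻ x, ENNReal.ofReal (f x) ∂ν')
    {x y : ℝ} (hx : x ∈ I) (hy : y ∈ I) : f x = f y := by
  wlog hxy : x ≤ y generalizing x y
  · exact (this hy hx (le_of_not_ge hxy)).symm
  by_contra hne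
  have hfxy : f y < f x := lt_of_le_of_ne (hf hx hy hxy) (Ne.symm hne)
  have key : ∀ t, (∃ s ∈ I, ν {a | t < f a} = ν (Iic s) ∧ ν' {a | t < f a} = ν' (Iic s)) ∨
      ν {a | t < f a} = ν' {a | t < f a} ∧ ((∀ a ∈ I, f a ≤ t) ∨ ∀ a ∈ I, t < f a) := by
    intro t
    have hinter : ∀ μ : Measure ℝ, (∀ᵐ x ∂μ, x ∈ I) →
        μ {a | t < f a} = μ {a | a ∈ I ∧ t < f a} := fun μ hμ => by
      refine measure_congr ?_
      filter_upwards [hμ] with z hz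
      exact propext ⟨fun h => ⟨hz, h⟩, fun h => h.2⟩
    rw [hinter ν hν, hinter ν' hν']
    by_cases h1 : ∀ a ∈ I, f a ≤ t
    · refine Or.inr ⟨?_, Or.inl h1⟩
      have : {a | a ∈ I ∧ t < f a} = ∅ := by
        ext a
        simpa using h1 a
      simp [this]
    by_cases h2 : ∀ a ∈ I, t < f a
    · refine Or.inr ⟨?_, Or.inr h2⟩
      have : {a | a ∈ I ∧ t < f a} = I := by
        ext a
        simpa using h2 a
      simp [this, hmass]
    push Not at h1 h2
    obtain ⟨p, hp, hpt⟩ := h1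
    obtain ⟨q, hq, hqt⟩ := h2
    obtain ⟨s, hs, h⟩ := exists_ae_eq_Iic_of_lower (S := {a | a ∈ I ∧ t < f a}) hI
      (fun a ha => ha.1) (fun a ha z hz hza => ⟨hz, ha.2.trans_le (hf hz ha.1 hza)⟩)
      ⟨p, hp, hpt⟩ hq (fun h => hqt.not_gt h.2)
    exact Or.inl ⟨s, hs, h ν ‹_› hν, h ν' ‹_› hν'⟩
  have hmeas : ∀ μ : Measure ℝ, (∀ᵐ x ∂μ, x ∈ I) → AEMeasurable f μ := fun μ hμ => by
    rw [← Measure.restrict_eq_self_of_ae_mem hμ]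
    exact aemeasurable_restrict_of_antitoneOn hIm hf
  have hnn : ∀ μ : Measure ℝ, (∀ᵐ x ∂μ, x ∈ I) → 0 ≤ᵐ[μ] f := fun μ hμ => hμ.mono hf0
  rw [lintegral_eq_lintegral_meas_lt ν (hnn ν hν) (hmeas ν hν),
    lintegral_eq_lintegral_meas_lt ν' (hnn ν' hν') (hmeas ν' hν')] at hle
  rw [lintegral_eq_lintegral_meas_lt ν' (hnn ν' hν') (hmeas ν' hν')] at hfin
  have hanti : ∀ μ : Measure ℝ, Antitone fun t : ℝ => μ {a | t < f a} := fun μ s t hst =>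
    measure_mono fun a (ha : t < f a) => hst.trans_lt ha
  have hae := ae_eq_of_ae_le_of_lintegral_le (μ := volume.restrict (Ioi (0 : ℝ)))
    (f := fun t => ν' {a | t < f a}) (g := fun t => ν {a | t < f a})
    (Filter.Eventually.of_forall fun t => by
      rcases key t with ⟨s, hs, h1, h2⟩ | ⟨h, -⟩
      · simpa only [h1, h2] using (hlt s hs).le
      · exact h.ge) hfin (hanti ν).measurable.aemeasurable hle
  rw [Filter.EventuallyEq, ae_restrict_iff' measurableSet_Ioi] at hae
  have hpos : volume (Ioo (f y) (f x)) ≠ 0 := by simpa using hfxy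
  obtain ⟨t, hteq, ht⟩ : ∃ t, ν' {a | t < f a} = ν {a | t < f a} ∧ t ∈ Ioo (f y) (f x) := by
    by_contra! h
    refine hpos (measure_mono_null (fun t ht => ?_) hae)
    exact fun heq => h t (heq ((hf0 y hy).trans_lt ht.1)) ht
  rcases key t with ⟨s, hs, h1, h2⟩ | ⟨-, h | h⟩
  · rw [h1, h2] at hteq
    exact (hlt s hs).ne hteq
  · exact (h x hx).not_gt ht.2
  · exact (h y hy).not_gt ht.1

theorem indicator_Ici_sub_indicator_Ici (c x : ℝ) :
    (fun t => (Ici c).indicator (1 : ℝ → ℝ) t - (Ici x).indicator (1 : ℝ → ℝ) t) =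
      fun t => (Ico c x).indicator 1 t - (Ico x c).indicator 1 t := by
  ext t
  simp only [indicator, mem_Ici, mem_Ico, Pi.one_apply]
  grind

theorem abs_indicator_Ici_sub_indicator_Ici (c x : ℝ) :
    (fun t => |(Ici c).indicator (1 : ℝ → ℝ) t - (Ici x).indicator (1 : ℝ → ℝ) t|) =
      fun t => (Ico c x).indicator 1 t + (Ico x c).indicator 1 t := by
  ext t
  simp only [indicator, mem_Ici, mem_Ico, Pi.one_apply]
  grind

/-- The mean of a density on an interval, expressed through its distribution function. -/
theorem integral_indicator_sub_cdf {I : Set ℝ} (hI : I.OrdConnected) (hIm : MeasurableSet I)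
    {c : ℝ} (hc : c ∈ I) {h : ℝ → ℝ} (hint : IntegrableOn h I)
    (hmean : IntegrableOn (fun x => x * h x) I) :
    IntegrableOn (fun t => (Ici c).indicator 1 t * (∫ x in I, h x) - ∫ x in I ∩ Iic t, h x) I ∧
      ∫ t in I, ((Ici c).indicator 1 t * (∫ x in I, h x) - ∫ x in I ∩ Iic t, h x) =
        (∫ x in I, x * h x) - c * ∫ x in I, h x := by
  have hIco : ∀ a ∈ I, ∀ b ∈ I, IntegrableOn ((Ico a b).indicator (1 : ℝ → ℝ)) I ∧
      ∫ t in I, (Ico a b).indicator (1 : ℝ → ℝ) t = max (b - a) 0 := fun a ha b hb => by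
    have hsub : Ico a b ⊆ I := Ico_subset_Icc_self.trans (hI.out ha hb)
    refine ⟨((integrable_indicator_iff measurableSet_Ico).2
      (integrableOn_const (by simp))).integrableOn, ?_⟩
    rw [integral_indicator_one measurableSet_Ico, Measure.real,
      Measure.restrict_apply measurableSet_Ico, inter_eq_left.2 hsub, Real.volume_Ico,
      ENNReal.toReal_ofReal']
  set K : ℝ → ℝ → ℝ := fun x t => (Ici c).indicator 1 t - (Ici x).indicator 1 t with hK
  have hKint : ∀ x ∈ I, IntegrableOn (K x) I ∧ ∫ t in I, K x t = x - c ∧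
      ∫ t in I, |K x t| = |x - c| := fun x hx => by
    obtain ⟨i1, e1⟩ := hIco c hc x hx
    obtain ⟨i2, e2⟩ := hIco x hx c hc
    simp only [hK, abs_indicator_Ici_sub_indicator_Ici, indicator_Ici_sub_indicator_Ici]
    refine ⟨i1.sub i2, ?_, ?_⟩
    · rw [integral_sub i1 i2, e1, e2]
      grind
    · rw [integral_add i1 i2, e1, e2]
      grind
  have hKmeas : Measurable fun p : ℝ × ℝ => K p.1 p.2 := by
    have h1 : Measurable fun p : ℝ × ℝ => (Ici c).indicator (1 : ℝ → ℝ) p.2 :=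
      (measurable_one.indicator measurableSet_Ici).comp measurable_snd
    have h2 : Measurable fun p : ℝ × ℝ => (Ici p.1).indicator (1 : ℝ → ℝ) p.2 :=
      Measurable.ite (measurableSet_le measurable_fst measurable_snd) measurable_const
        measurable_const
    exact h1.sub h2
  have hcint : Integrable (fun x => (x - c) * h x) (volume.restrict I) := by
    simp only [sub_mul]
    exact hmean.sub (hint.const_mul c)
  have hprod : Integrable (fun p : ℝ × ℝ => K p.1 p.2 * h p.1)
      ((volume.restrict I).prod (volume.restrict I)) := by
    have hmeas : AEStronglyMeasurable (fun p : ℝ × ℝ => K p.1 p.2 * h p.1)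
        ((volume.restrict I).prod (volume.restrict I)) :=
      hKmeas.aestronglyMeasurable.mul hint.aestronglyMeasurable.comp_fst
    refine (integrable_prod_iff hmeas).2 ⟨?_, ?_⟩
    · filter_upwards [ae_restrict_mem hIm] with x hx
      exact (hKint x hx).1.mul_const _
    · refine hcint.norm.congr ?_
      filter_upwards [ae_restrict_mem hIm] with x hx
      simp only [norm_mul, integral_mul_const, Real.norm_eq_abs, (hKint x hx).2.2]
  have hinner : ∀ t, ∫ x in I, K x t * h x =
      (Ici c).indicator 1 t * (∫ x in I, h x) - ∫ x in I ∩ Iic t, h x := fun t => by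
    have : ∀ x, K x t * h x = (Ici c).indicator 1 t * h x - (Iic t).indicator h x := fun x => by
      simp only [hK, indicator, mem_Ici, mem_Iic, Pi.one_apply]
      split_ifs <;> ring
    simp only [this]
    rw [integral_sub (hint.const_mul _) (hint.indicator measurableSet_Iic), integral_const_mul,
      setIntegral_indicator measurableSet_Iic]
  refine ⟨hprod.integral_prod_right.congr (Filter.Eventually.of_forall hinner), ?_⟩
  rw [← integral_congr_ae (Filter.Eventually.of_forall hinner), ← integral_prod_symm _ hprod,
    integral_prod _ hprod, ← integral_const_mul, ← integral_sub hmean (hint.const_mul c)]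
  refine setIntegral_congr_fun hIm fun x hx => ?_
  simp only [integral_mul_const, (hKint x hx).2.1]
  ring

/-- **Key step of Proposition 3: the normalized regular family has `γ ≡ 1`.**
For each `v ∈ [vlo, vhi]`, let `H v` be the CDF of an integrable probability distribution
with continuous strictly positive density `h v` on `(Vlo, Vhi)`; suppose `v ↦ H v V` is
continuously differentiable with derivative `Hv v V < 0`, dominated by an integrable `b`;
suppose the normalization `E[V | v] = ∫ V · h v V dV = v` holds for every `v`, and
Assumptions A1 and A2 hold.  Then `-∂H_v(V)/∂v = h_v(V)` for all `v ∈ (vlo, vhi)` and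
`V ∈ (Vlo, Vhi)`; equivalently `γ(v, V) = -(∂H_v(V)/∂v)/h_v(V) = 1` everywhere there. -/
theorem stmt_9
    (vlo vhi : ℝ) (hv : vlo < vhi)
    (Vlo Vhi : EReal) (hV : Vlo < Vhi)
    (H h Hv : ℝ → ℝ → ℝ)
    -- `h v` is a continuous strictly positive density on `(Vlo, Vhi)`
    (hh_cont : ∀ v ∈ Icc vlo vhi, ContinuousOn (h v) (ERIoo Vlo Vhi))
    (hh_pos : ∀ v ∈ Icc vlo vhi, ∀ V ∈ ERIoo Vlo Vhi, 0 < h v V)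
    (hh_int : ∀ v ∈ Icc vlo vhi, IntegrableOn (h v) (ERIoo Vlo Vhi))
    -- `H v` is the corresponding CDF of a probability distribution
    (hmono : ∀ v ∈ Icc vlo vhi, Monotone (H v))
    (hcdf : ∀ v ∈ Icc vlo vhi, ∀ x ∈ ERIoo Vlo Vhi,
      H v x = ∫ t in ERIoo Vlo Vhi ∩ Iic x, h v t)
    (hmass : ∀ v ∈ Icc vlo vhi, ∫ t in ERIoo Vlo Vhi, h v t = 1)
    -- the distribution is integrable, normalized so that `E[V | v] = v`
    (hmean_int : ∀ v ∈ Icc vlo vhi, IntegrableOn (fun x => x * h v x) (ERIoo Vlo Vhi))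
    (hnorm : ∀ v ∈ Icc vlo vhi, ∫ x in ERIoo Vlo Vhi, x * h v x = v)
    -- `v ↦ H v V` is continuously differentiable, strictly decreasing in `v`
    (hH_deriv : ∀ V ∈ ERIoo Vlo Vhi, ∀ v ∈ Icc vlo vhi,
      HasDerivWithinAt (fun v => H v V) (Hv v V) (Icc vlo vhi) v)
    (hHv_cont : ∀ V ∈ ERIoo Vlo Vhi, ContinuousOn (fun v => Hv v V) (Icc vlo vhi))
    (hHv_neg : ∀ v ∈ Icc vlo vhi, ∀ V ∈ ERIoo Vlo Vhi, Hv v V < 0)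
    -- dominating integrable function
    (b : ℝ → ℝ)
    (hb_nonneg : ∀ V ∈ ERIoo Vlo Vhi, 0 ≤ b V)
    (hb_int : IntegrableOn b (ERIoo Vlo Vhi))
    (hb_dom : ∀ v ∈ Icc vlo vhi, ∀ V ∈ ERIoo Vlo Vhi, |Hv v V| ≤ b V)
    -- Assumptions A1 and A2
    (hA1 : ∀ v ∈ Icc vlo vhi, MonotoneOn (fun V => Hv v V / h v V) (ERIoo Vlo Vhi))
    (hA2 : ∀ V ∈ ERIoo Vlo Vhi, MonotoneOn (fun v => Hv v V / h v V) (Ioo vlo vhi)) :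
    ∀ v ∈ Ioo vlo vhi, ∀ V ∈ ERIoo Vlo Vhi, -Hv v V = h v V := by
  set I := ERIoo Vlo Vhi
  have hIm : MeasurableSet I := ERIoo.measurableSet Vlo Vhi
  have hIc : I.OrdConnected := ERIoo.ordConnected Vlo Vhi
  obtain ⟨c, hc⟩ : I.Nonempty := ERIoo.nonempty hV
  have hderiv : ∀ V ∈ I, ∀ v ∈ Ioo vlo vhi, HasDerivAt (fun v => H v V) (Hv v V) v :=
    fun V hVI v hvI => (hH_deriv V hVI v (Ioo_subset_Icc_self hvI)).hasDerivAt
      (Icc_mem_nhds hvI.1 hvI.2)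
  have hHanti : ∀ V ∈ I, StrictAntiOn (fun v => H v V) (Icc vlo vhi) := fun V hVI => by
    refine strictAntiOn_of_deriv_neg (convex_Icc _ _)
      (fun v hvI => (hH_deriv V hVI v hvI).continuousWithinAt) fun v hvI => ?_
    rw [interior_Icc] at hvI
    rw [(hderiv V hVI v hvI).deriv]
    exact hHv_neg v (Ioo_subset_Icc_self hvI) V hVI
  have hHdiff : ∀ v ∈ Icc vlo vhi, ∀ w ∈ Icc vlo vhi,
      IntegrableOn (fun x => H w x - H v x) I ∧ ∫ x in I, (H w x - H v x) = v - w := by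
    intro v hvI w hwI
    obtain ⟨i1, e1⟩ := integral_indicator_sub_cdf hIc hIm hc (hh_int v hvI) (hmean_int v hvI)
    obtain ⟨i2, e2⟩ := integral_indicator_sub_cdf hIc hIm hc (hh_int w hwI) (hmean_int w hwI)
    rw [hnorm v hvI, hmass v hvI] at e1
    rw [hnorm w hwI, hmass w hwI] at e2
    have heq : EqOn (fun t => ((Ici c).indicator 1 t * (∫ x in I, h v x) -
        ∫ x in I ∩ Iic t, h v x) - ((Ici c).indicator 1 t * (∫ x in I, h w x) -
        ∫ x in I ∩ Iic t, h w x)) (fun x => H w x - H v x) I := fun t ht => by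
      simp only [hmass v hvI, hmass w hwI, hcdf v hvI t ht, hcdf w hwI t ht]
      ring
    refine ⟨(i1.sub i2).congr_fun heq hIm, ?_⟩
    rw [← setIntegral_congr_fun hIm heq, integral_sub i1 i2, hmass v hvI, hmass w hwI, e1, e2]
    ring
  have hratio : ∀ v ∈ Icc vlo vhi, ∀ V ∈ I, Hv v V / h v V * h v V = Hv v V :=
    fun v hvI V hVI => div_mul_cancel₀ _ (hh_pos v hvI V hVI).ne'
  have hHv_int : ∀ v ∈ Ioo vlo vhi, IntegrableOn (Hv v) I ∧ ∫ x in I, Hv v x = -1 := by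
    intro v hvI
    have hvI' := Ioo_subset_Icc_self hvI
    have hmeas : AEStronglyMeasurable (Hv v) (volume.restrict I) := by
      refine (((aemeasurable_restrict_of_monotoneOn hIm (hA1 v hvI')).mul
        (hh_int v hvI').aestronglyMeasurable.aemeasurable).congr ?_).aestronglyMeasurable
      filter_upwards [ae_restrict_mem hIm] with x hx using hratio v hvI' x hx
    obtain ⟨hi, hd⟩ := hasDerivAt_integral_of_dominated_loc_of_deriv_le
      (μ := volume.restrict I) (F := fun w x => H w x - H v x) (F' := Hv) (bound := b)
      (Ioo_mem_nhds hvI.1 hvI.2)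
      (by
        filter_upwards [Icc_mem_nhds hvI.1 hvI.2] with w hw
        exact (hHdiff v hvI' w hw).1.aestronglyMeasurable)
      (hHdiff v hvI' v hvI').1 hmeas
      (by
        filter_upwards [ae_restrict_mem hIm] with x hx w hw
        exact hb_dom w (Ioo_subset_Icc_self hw) x hx)
      hb_int
      (by
        filter_upwards [ae_restrict_mem hIm] with x hx w hw
        exact (hderiv x hx w hw).sub_const _)
    refine ⟨hi, hd.unique (HasDerivAt.congr_of_eventuallyEq ((hasDerivAt_id v).const_sub v) ?_)⟩
    filter_upwards [Icc_mem_nhds hvI.1 hvI.2] with w hw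
    exact (hHdiff v hvI' w hw).2
  intro w hwI V hVI
  have hwI' := Ioo_subset_Icc_self hwI
  obtain ⟨v, hlv, hvw⟩ := exists_between hwI.1
  have hvI : v ∈ Ioo vlo vhi := ⟨hlv, hvw.trans hwI.2⟩
  have hvI' := Ioo_subset_Icc_self hvI
  set P : ℝ → Measure ℝ := fun u => (volume.restrict I).withDensity fun x => ENNReal.ofReal (h u x)
    with hP
  have hPac : ∀ u, P u ≪ volume.restrict I := fun u => withDensity_absolutelyContinuous _ _
  have hPI : ∀ u, ∀ᵐ x ∂P u, x ∈ I := fun u => (hPac u).ae_le (ae_restrict_mem hIm)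
  have hPatom : ∀ u, NullSingletonClass (P u) := fun u => ⟨fun x => hPac u (by simp)⟩
  have hPapply : ∀ u ∈ Icc vlo vhi, ∀ S, MeasurableSet S →
      P u S = ENNReal.ofReal (∫ x in I ∩ S, h u x) := fun u hu S hS => by
    rw [hP, withDensity_apply _ hS, Measure.restrict_restrict hS, inter_comm,
      ofReal_integral_eq_lintegral_ofReal ((hh_int u hu).mono_set inter_subset_left)]
    filter_upwards [ae_restrict_mem (hIm.inter hS)] with x hx using (hh_pos u hu x hx.1).le
  have hPmass : ∀ u ∈ Icc vlo vhi, P u I = 1 := fun u hu => by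
    rw [hPapply u hu I hIm, inter_self, hmass u hu, ENNReal.ofReal_one]
  have hPexp : ∀ u ∈ Icc vlo vhi, ∀ f : ℝ → ℝ, AntitoneOn f I →
      ∫⁻ x, ENNReal.ofReal (f x) ∂P u = ∫⁻ x in I, ENNReal.ofReal (f x * h u x) := by
    intro u hu f hf
    rw [hP, lintegral_withDensity_eq_lintegral_mul₀
      (hh_int u hu).aestronglyMeasurable.aemeasurable.ennreal_ofReal
      (aemeasurable_restrict_of_antitoneOn hIm hf).ennreal_ofReal]
    refine setLIntegral_congr_fun hIm fun x hx => ?_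
    rw [Pi.mul_apply, ← ENNReal.ofReal_mul (hh_pos u hu x hx).le, mul_comm]
  have hγpos : ∀ u ∈ Icc vlo vhi, ∀ x ∈ I, 0 ≤ -(Hv u x / h u x) := fun u hu x hx =>
    neg_nonneg.2 (div_neg_of_neg_of_pos (hHv_neg u hu x hx) (hh_pos u hu x hx)).le
  have hγanti : ∀ u ∈ Icc vlo vhi, AntitoneOn (fun x => -(Hv u x / h u x)) I :=
    fun u hu => (hA1 u hu).neg
  have hγexp : ∀ u ∈ Ioo vlo vhi, ∫⁻ x, ENNReal.ofReal (-(Hv u x / h u x)) ∂P u = 1 := by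
    intro u hu
    have hu' := Ioo_subset_Icc_self hu
    have heq : EqOn (fun x => ENNReal.ofReal (-(Hv u x / h u x) * h u x))
        (fun x => ENNReal.ofReal (-Hv u x)) I := fun x hx => by
      simp only [neg_mul, hratio u hu' x hx]
    have hnn : 0 ≤ᵐ[volume.restrict I] fun x => -Hv u x := by
      filter_upwards [ae_restrict_mem hIm] with x hx using (neg_pos.2 (hHv_neg u hu' x hx)).le
    rw [hPexp u hu' _ (hγanti u hu'), setLIntegral_congr_fun hIm heq,
      ← ofReal_integral_eq_lintegral_ofReal (f := fun x => -Hv u x) (hHv_int u hu).1.neg hnn,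
      integral_neg, (hHv_int u hu).2, neg_neg, ENNReal.ofReal_one]
  have hconst : ∀ x ∈ I, -(Hv w x / h w x) = -(Hv w V / h w V) := fun x hx => by
    have := hPatom v
    have := hPatom w
    refine (hγanti w hwI').eq_of_strict_stochastic_dominance hIc hIm (hPI v) (hPI w)
      ((hPmass v hvI').trans (hPmass w hwI').symm) (fun s hs => ?_) (hγpos w hwI') ?_ ?_ hx hVI
    · have hlt : H w s < H v s := hHanti s hs hvI' hwI' hvw
      have hnn : 0 ≤ H w s := by
        rw [hcdf w hwI' s hs]
        exact setIntegral_nonneg (hIm.inter measurableSet_Iic)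
          fun x hx => (hh_pos w hwI' x hx.1).le
      rw [hPapply w hwI' _ measurableSet_Iic, hPapply v hvI' _ measurableSet_Iic,
        ← hcdf w hwI' s hs, ← hcdf v hvI' s hs]
      exact (ENNReal.ofReal_lt_ofReal_iff (hnn.trans_lt hlt)).2 hlt
    · rw [hγexp w hwI]
      exact ENNReal.one_ne_top
    · rw [hγexp w hwI, ← hγexp v hvI]
      refine lintegral_mono_ae ?_
      filter_upwards [hPI v] with x hx
      exact ENNReal.ofReal_le_ofReal (neg_le_neg (hA2 x hx hvI hwI hvw.le))
  have hone : Hv w V / h w V = -1 := by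
    have heq : EqOn (Hv w) (fun x => Hv w V / h w V * h w x) I := fun x hx => by
      rw [← neg_inj.1 (hconst x hx)]
      exact (hratio w hwI' x hx).symm
    rw [← (hHv_int w hwI).2, setIntegral_congr_fun hIm heq, integral_const_mul, hmass w hwI',
      mul_one]
  rw [← hratio w hwI' V hVI, hone, neg_one_mul, neg_neg]
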